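/- Let a, b, c be positive integers and let {w_n} be the integer bi-periodic Horadam sequence with integer initial values w_0, w_1, and {v_n} the bi-periodic Lucas sequence. Then for all integers n, m, r, d > 0, v_m divides b^n·(w_{2(m+r)n+d} − (−1)^{n(m+1)}·c^{mn}·w_{2rn+d}). (This is the denominator-cleared form of the congruence w_{2(m+r)n+d} ≡ (−1)^{n(m+1)}·c^{mn}·w_{2rn+d} (mod v_m).) -/

import Mathlib

/-- The integer bi-periodic Horadam sequence with parameters `a, b, c` and
initial values `w0, w1`; the bi-periodic Lucas sequence is the
special case with initial values `2, b`. -/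
def biperZ (a b c w0 w1 : ℤ) : ℕ → ℤ
  | 0 => w0
  | 1 => w1
  | n + 2 => (if Even (n + 2) then a else b) * biperZ a b c w0 w1 (n + 1)
      + c * biperZ a b c w0 w1 n

theorem biperZ_add_two_of_even (a b c w0 w1 : ℤ) {k : ℕ} (hk : Even k) :
    biperZ a b c w0 w1 (k + 2) = a * biperZ a b c w0 w1 (k + 1) + c * biperZ a b c w0 w1 k := by
  rw [biperZ, if_pos (by grind)]

theorem biperZ_add_two_of_odd (a b c w0 w1 : ℤ) {k : ℕ} (hk : Odd k) :
    biperZ a b c w0 w1 (k + 2) = b * biperZ a b c w0 w1 (k + 1) + c * biperZ a b c w0 w1 k := by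
  rw [biperZ, if_neg (by grind)]

/-- Product formulas for a bi-periodic Lucas number and a bi-periodic Horadam number. -/
theorem biperZ_lucas_mul (a b c w0 w1 : ℤ) (j : ℕ) :
    (∀ k, biperZ a b c 2 b (2 * j) * biperZ a b c w0 w1 (k + 2 * j)
      = biperZ a b c w0 w1 (k + 4 * j) + c ^ (2 * j) * biperZ a b c w0 w1 k) ∧
    (∀ k, Odd k → biperZ a b c 2 b (2 * j + 1) * biperZ a b c w0 w1 (k + 2 * j + 1)
      = biperZ a b c w0 w1 (k + 4 * j + 2) - c ^ (2 * j + 1) * biperZ a b c w0 w1 k) ∧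
    (∀ k, Even k → a * (biperZ a b c 2 b (2 * j + 1) * biperZ a b c w0 w1 (k + 2 * j + 1))
      = b * (biperZ a b c w0 w1 (k + 4 * j + 2)
        - c ^ (2 * j + 1) * biperZ a b c w0 w1 k)) := by
  induction j with
  | zero =>
    refine ⟨fun k => ?_, fun k hk => ?_, fun k hk => ?_⟩
    · simp [biperZ]; ring
    · simp only [mul_zero, zero_add, add_zero, pow_one,
        biperZ_add_two_of_odd a b c w0 w1 hk]
      simp only [biperZ]
      ring
    · simp only [mul_zero, zero_add, add_zero, pow_one,
        biperZ_add_two_of_even a b c w0 w1 hk]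
      simp only [biperZ]
      ring
  | succ j ih =>
    obtain ⟨h0, h1, h2⟩ := ih
    have heven : ∀ k, biperZ a b c 2 b (2 * (j + 1)) * biperZ a b c w0 w1 (k + 2 * (j + 1))
        = biperZ a b c w0 w1 (k + 4 * (j + 1))
          + c ^ (2 * (j + 1)) * biperZ a b c w0 w1 k := by
      intro k
      have hv := biperZ_add_two_of_even a b c 2 b (k := 2 * j) (by simp)
      have e0 := h0 (k + 2)
      rw [show k + 2 + 2 * j = k + 2 * (j + 1) by ring,
        show k + 2 + 4 * j = k + 4 * j + 2 by ring] at e0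
      rw [show 2 * (j + 1) = 2 * j + 2 by ring] at e0 ⊢
      rw [show k + 4 * (j + 1) = k + 4 * j + 2 + 2 by ring, hv]
      rcases Nat.even_or_odd k with hk | hk
      · have e1 := h1 (k + 1) (by grind)
        rw [show k + 1 + 2 * j + 1 = k + (2 * j + 2) by ring,
          show k + 1 + 4 * j + 2 = k + 4 * j + 2 + 1 by ring] at e1
        rw [biperZ_add_two_of_even a b c w0 w1 (k := k + 4 * j + 2) (by grind)]
        rw [biperZ_add_two_of_even a b c w0 w1 hk] at e0
        linear_combination a * e1 + c * e0
      · have e1 := h2 (k + 1) (by grind)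
        rw [show k + 1 + 2 * j + 1 = k + (2 * j + 2) by ring,
          show k + 1 + 4 * j + 2 = k + 4 * j + 2 + 1 by ring] at e1
        rw [biperZ_add_two_of_odd a b c w0 w1 (k := k + 4 * j + 2) (by grind)]
        rw [biperZ_add_two_of_odd a b c w0 w1 hk] at e0
        linear_combination e1 + c * e0
    have hv := biperZ_add_two_of_odd a b c 2 b (k := 2 * j + 1) (by simp)
    refine ⟨heven, fun k hk => ?_, fun k hk => ?_⟩
    · have e0 := heven (k + 1)
      have e1 := h1 (k + 2) (by grind)
      rw [show k + 1 + 2 * (j + 1) = k + 2 * j + 3 by ring,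
        show k + 1 + 4 * (j + 1) = k + 4 * j + 4 + 1 by ring,
        show 2 * (j + 1) = 2 * j + 1 + 1 by ring] at e0
      rw [show k + 2 + 2 * j + 1 = k + 2 * j + 3 by ring,
        show k + 2 + 4 * j + 2 = k + 4 * j + 4 by ring,
        biperZ_add_two_of_odd a b c w0 w1 hk] at e1
      rw [show k + 2 * (j + 1) + 1 = k + 2 * j + 3 by ring,
        show k + 4 * (j + 1) + 2 = k + 4 * j + 4 + 2 by ring,
        show 2 * (j + 1) + 1 = 2 * j + 1 + 2 by ring, hv,
        biperZ_add_two_of_odd a b c w0 w1 (k := k + 4 * j + 4) (by grind)]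
      linear_combination b * e0 + c * e1
    · have e0 := heven (k + 1)
      have e1 := h2 (k + 2) (by grind)
      rw [show k + 1 + 2 * (j + 1) = k + 2 * j + 3 by ring,
        show k + 1 + 4 * (j + 1) = k + 4 * j + 4 + 1 by ring,
        show 2 * (j + 1) = 2 * j + 1 + 1 by ring] at e0
      rw [show k + 2 + 2 * j + 1 = k + 2 * j + 3 by ring,
        show k + 2 + 4 * j + 2 = k + 4 * j + 4 by ring,
        biperZ_add_two_of_even a b c w0 w1 hk] at e1
      rw [show k + 2 * (j + 1) + 1 = k + 2 * j + 3 by ring,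
        show k + 4 * (j + 1) + 2 = k + 4 * j + 4 + 2 by ring,
        show 2 * (j + 1) + 1 = 2 * j + 1 + 2 by ring, hv,
        biperZ_add_two_of_even a b c w0 w1 (k := k + 4 * j + 4) (by grind)]
      linear_combination a * b * e0 + c * e1

theorem biperZ_lucas_dvd (a b c w0 w1 : ℤ) (m k : ℕ) :
    biperZ a b c 2 b m ∣ b * (biperZ a b c w0 w1 (k + 2 * m)
      - (-1) ^ (m + 1) * c ^ m * biperZ a b c w0 w1 k) := by
  rcases Nat.even_or_odd' m with ⟨j, rfl | rfl⟩
  · have h := (biperZ_lucas_mul a b c w0 w1 j).1 k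
    refine ⟨b * biperZ a b c w0 w1 (k + 2 * j), ?_⟩
    rw [show k + 2 * (2 * j) = k + 4 * j by ring, pow_succ, pow_mul, neg_one_sq, one_pow]
    linear_combination -b * h
  · obtain ⟨-, h1, h2⟩ := biperZ_lucas_mul a b c w0 w1 j
    rw [show k + 2 * (2 * j + 1) = k + 4 * j + 2 by ring,
      show 2 * j + 1 + 1 = 2 * (j + 1) by ring, pow_mul (-1 : ℤ), neg_one_sq, one_pow, one_mul]
    rcases Nat.even_or_odd k with hk | hk
    · exact ⟨a * biperZ a b c w0 w1 (k + 2 * j + 1), by linear_combination -h2 k hk⟩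
    · exact ⟨b * biperZ a b c w0 w1 (k + 2 * j + 1), by linear_combination -b * h1 k hk⟩

theorem biperZ_lucas_dvd_pow (a b c w0 w1 : ℤ) (m k n : ℕ) :
    biperZ a b c 2 b m ∣ b ^ n * (biperZ a b c w0 w1 (k + 2 * m * n)
      - ((-1) ^ (m + 1) * c ^ m) ^ n * biperZ a b c w0 w1 k) := by
  induction n with
  | zero => simp
  | succ n ih =>
    have h := biperZ_lucas_dvd a b c w0 w1 m (k + 2 * m * n)
    rw [show k + 2 * m * n + 2 * m = k + 2 * m * (n + 1) by ring] at h
    refine (dvd_add (h.mul_left (b ^ n))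
      (ih.mul_left (b * ((-1) ^ (m + 1) * c ^ m)))).trans (dvd_of_eq ?_)
    generalize (-1) ^ (m + 1) * c ^ m = s
    ring

theorem stmt17 (a b c w0 w1 : ℤ) (ha : 0 < a) (hb : 0 < b) (hc : 0 < c)
    (n m r d : ℕ) (hn : 0 < n) (hm : 0 < m) (hr : 0 < r) (hd : 0 < d) :
    biperZ a b c 2 b m ∣
      b ^ n * (biperZ a b c w0 w1 (2 * (m + r) * n + d)
        - (-1) ^ (n * (m + 1)) * c ^ (m * n) * biperZ a b c w0 w1 (2 * r * n + d)) := by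
  have h := biperZ_lucas_dvd_pow a b c w0 w1 m (2 * r * n + d) n
  rwa [mul_pow, ← pow_mul, ← pow_mul, mul_comm (m + 1) n,
    show 2 * r * n + d + 2 * m * n = 2 * (m + r) * n + d by ring] at h
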